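/- Let S₁ = {s(1) < s(2) < ... < s(k)} be a finite set of positive integers with s(1) = 1 and k ≥ 2, and let S₂ = {s(1), ..., s(k−1)} ∪ {m : m ≥ s(k) + 1}. Then the open interval (H(S₂), H(S₁)) contains no point of D = {H(S) : S a set of positive integers with 1 ∈ S}; i.e., this interval is a gap in D. -/

import Mathlib

open scoped Classical

/-- `charFn S` is the characteristic function `u` of a set `S` of positive integers. -/
noncomputable def charFn (S : Set ℕ) (n : ℕ) : ℝ := if n ∈ S then 1 else 0

/-- `H S = ∏_p (1 + Σ_{i ≥ 2} (u(i) - u(i-1)) / p^i)`, the product over all primes. -/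
noncomputable def H (S : Set ℕ) : ℝ :=
  ∏' p : Nat.Primes,
    (1 + ∑' i : ℕ, (charFn S (i + 2) - charFn S (i + 1)) / ((p : ℕ) : ℝ) ^ (i + 2))

/-- The exponentially `S`-numbers: positive integers all of whose prime-factorization
exponents lie in `S`. -/
def ExpS (S : Set ℕ) : Set ℕ :=
  {N | 0 < N ∧ ∀ p : ℕ, p.Prime → p ∣ N → N.factorization p ∈ S}

/-- The set `D` of all densities `H S` as `S` ranges over sets of positive integers
containing `1`. -/
noncomputable def densitySet : Set ℝ :=
  {x | ∃ S : Set ℕ, 1 ∈ S ∧ (∀ n ∈ S, 0 < n) ∧ H S = x}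

theorem charFn_nonneg (S : Set ℕ) (n : ℕ) : 0 ≤ charFn S n := by
  unfold charFn; split_ifs <;> norm_num

theorem charFn_le_one (S : Set ℕ) (n : ℕ) : charFn S n ≤ 1 := by
  unfold charFn; split_ifs <;> norm_num

theorem summable_charFn_mul_pow (S : Set ℕ) {x : ℝ} (hx : 0 ≤ x) (hx' : x ≤ 1 / 2) (k : ℕ) :
    Summable fun i : ℕ => charFn S (i + k) * x ^ (i + k) := by
  have h : Summable fun i : ℕ => x ^ (i + k) :=
    (summable_nat_add_iff k).2 (summable_geometric_of_lt_one hx (by linarith))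
  refine Summable.of_nonneg_of_le (fun i => mul_nonneg (charFn_nonneg _ _) (pow_nonneg hx _))
    (fun i => ?_) h
  exact mul_le_of_le_one_left (pow_nonneg hx _) (charFn_le_one _ _)

theorem tsum_charFn_mul_pow_le (S : Set ℕ) {x : ℝ} (hx : 0 ≤ x) (hx' : x ≤ 1 / 2) (k : ℕ) :
    ∑' i : ℕ, charFn S (i + (k + 1)) * x ^ (i + (k + 1)) ≤ x ^ k := by
  have h : HasSum (fun i : ℕ => x ^ (i + (k + 1))) ((1 - x)⁻¹ * x ^ (k + 1)) := by
    simpa [pow_add] using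
      (hasSum_geometric_of_lt_one hx (by linarith)).mul_right (x ^ (k + 1))
  calc ∑' i : ℕ, charFn S (i + (k + 1)) * x ^ (i + (k + 1))
      ≤ ∑' i : ℕ, x ^ (i + (k + 1)) :=
        (summable_charFn_mul_pow S hx hx' _).tsum_le_tsum
          (fun i => mul_le_of_le_one_left (pow_nonneg hx _) (charFn_le_one _ _)) h.summable
    _ = (1 - x)⁻¹ * x * x ^ k := by rw [h.tsum_eq]; ring
    _ ≤ 1 * x ^ k := by
        gcongr
        rw [inv_mul_le_iff₀ (by linarith)]
        linarith
    _ = x ^ k := one_mul _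

/-- For `0 ≤ x ≤ 1/2`, the generating function of `S` at `x` is monotone for the order
comparing sets at the first place where they differ. -/
theorem tsum_charFn_mul_pow_mono {S T : Set ℕ} {k : ℕ} (hagree : ∀ i < k, i ∈ S ↔ i ∈ T)
    (hT : k ∈ T) (hS : k ∉ S) {x : ℝ} (hx : 0 ≤ x) (hx' : x ≤ 1 / 2) :
    ∑' i : ℕ, charFn S i * x ^ i ≤ ∑' i : ℕ, charFn T i * x ^ i := by
  have hs (S : Set ℕ) : Summable fun i : ℕ => charFn S i * x ^ i :=
    summable_charFn_mul_pow S hx hx' 0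
  rw [← (hs S).sum_add_tsum_nat_add (k + 1), ← (hs T).sum_add_tsum_nat_add (k + 1),
    Finset.sum_range_succ, Finset.sum_range_succ]
  have hsum : ∑ i ∈ Finset.range k, charFn S i * x ^ i
      = ∑ i ∈ Finset.range k, charFn T i * x ^ i :=
    Finset.sum_congr rfl fun i hi => by simp [charFn, hagree i (Finset.mem_range.1 hi)]
  have hSk : charFn S k = 0 := by simp [charFn, hS]
  have hTk : charFn T k = 1 := by simp [charFn, hT]
  have htail : 0 ≤ ∑' i : ℕ, charFn T (i + (k + 1)) * x ^ (i + (k + 1)) :=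
    tsum_nonneg fun i => mul_nonneg (charFn_nonneg _ _) (pow_nonneg hx _)
  rw [hsum, hSk, hTk]
  linarith [tsum_charFn_mul_pow_le S hx hx' k]

theorem one_add_tsum_charFn_sub {S : Set ℕ} (h0 : 0 ∉ S) (h1 : 1 ∈ S) {x : ℝ} (hx : 0 ≤ x)
    (hx' : x ≤ 1 / 2) :
    1 + ∑' i : ℕ, (charFn S (i + 2) - charFn S (i + 1)) * x ^ (i + 2)
      = (1 - x) * (1 + ∑' i : ℕ, charFn S i * x ^ i) := by
  have hs := summable_charFn_mul_pow S hx hx'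
  have hc0 : charFn S 0 = 0 := by simp [charFn, h0]
  have hc1 : charFn S 1 = 1 := by simp [charFn, h1]
  have e1 := (hs 0).sum_add_tsum_nat_add 1
  have e2 := (hs 0).sum_add_tsum_nat_add 2
  simp only [Finset.sum_range_succ, Finset.sum_range_zero, hc0, hc1, add_zero, zero_add,
    zero_mul, one_mul, pow_one] at e1 e2
  have e3 : ∑' i : ℕ, (charFn S (i + 2) - charFn S (i + 1)) * x ^ (i + 2)
      = ∑' i : ℕ, charFn S (i + 2) * x ^ (i + 2)
        - x * ∑' i : ℕ, charFn S (i + 1) * x ^ (i + 1) := by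
    rw [← tsum_mul_left, ← (hs 2).tsum_sub ((hs 1).mul_left x)]
    exact tsum_congr fun i => by ring
  rw [e3, e1]
  linear_combination e2

theorem abs_tsum_charFn_sub_le (S : Set ℕ) {x : ℝ} (hx : 0 ≤ x) (hx' : x ≤ 1 / 2) :
    |∑' i : ℕ, (charFn S (i + 2) - charFn S (i + 1)) * x ^ (i + 2)| ≤ 2 * x ^ 2 := by
  have h : HasSum (fun i : ℕ => x ^ (i + 2)) ((1 - x)⁻¹ * x ^ 2) := by
    simpa [pow_add] using
      (hasSum_geometric_of_lt_one hx (by linarith)).mul_right (x ^ 2)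
  rw [← Real.norm_eq_abs]
  refine (tsum_of_norm_bounded h fun i => ?_).trans ?_
  · rw [norm_mul, Real.norm_eq_abs, Real.norm_eq_abs, abs_of_nonneg (pow_nonneg hx _)]
    refine mul_le_of_le_one_left (pow_nonneg hx _) (abs_sub_le_iff.2 ⟨?_, ?_⟩) <;>
      linarith [charFn_nonneg S (i + 2), charFn_nonneg S (i + 1), charFn_le_one S (i + 2),
        charFn_le_one S (i + 1)]
  · gcongr
    rw [inv_le_comm₀ (by linarith) (by norm_num)]
    linarith

theorem Nat.Primes.inv_le_half (p : Nat.Primes) : (((p : ℕ) : ℝ))⁻¹ ≤ 1 / 2 := by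
  have : (2 : ℝ) ≤ (p : ℕ) := by exact_mod_cast p.2.two_le
  rw [one_div]
  gcongr

theorem H_eq_tprod (S : Set ℕ) :
    H S = ∏' p : Nat.Primes, (1 + ∑' i : ℕ,
      (charFn S (i + 2) - charFn S (i + 1)) * (((p : ℕ) : ℝ))⁻¹ ^ (i + 2)) := by
  simp only [H, inv_pow, div_eq_mul_inv]

theorem multipliable_localFactor (S : Set ℕ) :
    Multipliable fun p : Nat.Primes => (1 + ∑' i : ℕ,
      (charFn S (i + 2) - charFn S (i + 1)) * (((p : ℕ) : ℝ))⁻¹ ^ (i + 2)) := by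
  apply multipliable_one_add_of_summable
  have h : Summable fun p : Nat.Primes => 2 * (((p : ℕ) : ℝ))⁻¹ ^ 2 := by
    have := (Real.summable_nat_pow_inv (p := 2)).2 one_lt_two
    simpa only [inv_pow, Function.comp_def] using
      (this.comp_injective (i := fun p : Nat.Primes => (p : ℕ))
        Subtype.coe_injective).mul_left (2 : ℝ)
  exact h.of_nonneg_of_le (fun _ => norm_nonneg _) fun p =>
    abs_tsum_charFn_sub_le S (by positivity) p.inv_le_half

theorem H_le_of_first_difference {S T : Set ℕ} (hS0 : 0 ∉ S) (hS1 : 1 ∈ S) (hT0 : 0 ∉ T)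
    (hT1 : 1 ∈ T) {k : ℕ} (hagree : ∀ i < k, i ∈ S ↔ i ∈ T) (hT : k ∈ T) (hS : k ∉ S) :
    H S ≤ H T := by
  rw [H_eq_tprod, H_eq_tprod]
  refine le_of_tendsto_of_tendsto' (multipliable_localFactor S).hasProd
    (multipliable_localFactor T).hasProd fun s => ?_
  refine Finset.prod_le_prod (fun p _ => ?_) fun p _ => ?_
  all_goals
    have hx : (0 : ℝ) ≤ (((p : ℕ) : ℝ))⁻¹ := by positivity
    have hx' := p.inv_le_half
  · nlinarith [(abs_le.1 (abs_tsum_charFn_sub_le S hx hx')).1]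
  · rw [one_add_tsum_charFn_sub hS0 hS1 hx hx', one_add_tsum_charFn_sub hT0 hT1 hx hx']
    have := tsum_charFn_mul_pow_mono hagree hT hS hx hx'
    exact mul_le_mul_of_nonneg_left (by linarith) (by linarith)

theorem exists_first_difference {S T : Set ℕ} (h : S ≠ T) :
    ∃ k, (∀ i < k, i ∈ S ↔ i ∈ T) ∧ (k ∈ T ∧ k ∉ S ∨ k ∈ S ∧ k ∉ T) := by
  have hex : ∃ k, ¬(k ∈ S ↔ k ∈ T) := by
    by_contra! hc
    exact h (Set.ext hc)
  refine ⟨Nat.find hex, fun i hi => not_not.1 (Nat.find_min hex hi), ?_⟩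
  have := Nat.find_spec hex
  tauto

theorem gap_in_densitySet (S₁ : Set ℕ) (hfin : S₁.Finite) (h1 : 1 ∈ S₁)
    (hpos : ∀ n ∈ S₁, 0 < n) (t : ℕ) (ht : t ∈ S₁) (hmax : ∀ m ∈ S₁, m ≤ t)
    (ht1 : 1 < t) :
    ∀ x ∈ densitySet, x ∉ Set.Ioo (H ((S₁ \ {t}) ∪ {m : ℕ | t + 1 ≤ m})) (H S₁) := by
  rintro x ⟨S, hS1, hSpos, rfl⟩ ⟨hlow, hupp⟩
  have hS0 : 0 ∉ S := fun h => lt_irrefl _ (hSpos 0 h)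
  have h0 : 0 ∉ S₁ := fun h => lt_irrefl _ (hpos 0 h)
  have hmem (n : ℕ) : n ∈ (S₁ \ {t}) ∪ {m : ℕ | t + 1 ≤ m} ↔ n ∈ S₁ ∧ n ≠ t ∨ t + 1 ≤ n := by
    simp
  generalize (S₁ \ {t}) ∪ {m : ℕ | t + 1 ≤ m} = S₂ at hlow hmem
  have h20 : 0 ∉ S₂ := by simp [hmem, h0]
  have h21 : 1 ∈ S₂ := (hmem 1).2 (Or.inl ⟨h1, ht1.ne⟩)
  obtain ⟨m, hm, ⟨hm1, hm2⟩ | ⟨hm1, hm2⟩⟩ :=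
    exists_first_difference (S := S₂) (T := S) (by rintro rfl; exact lt_irrefl _ hlow)
  swap
  · exact hlow.not_ge
      (H_le_of_first_difference hS0 hS1 h20 h21 (fun i hi => (hm i hi).symm) hm1 hm2)
  obtain ⟨n, hn, ⟨hn1, hn2⟩ | ⟨hn1, hn2⟩⟩ :=
    exists_first_difference (S := S) (T := S₁) (by rintro rfl; exact lt_irrefl _ hupp)
  swap
  · exact hupp.not_ge
      (H_le_of_first_difference h0 h1 hS0 hS1 (fun i hi => (hn i hi).symm) hn1 hn2)
  have hnt := hmax n hn1
  have hmt : m ≤ t := by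
    by_contra! h
    exact hm2 ((hmem m).2 (Or.inr h))
  rcases lt_trichotomy n m with h | rfl | h
  · exact hn2 ((hm n h).1 ((hmem n).2 (Or.inl ⟨hn1, by omega⟩)))
  · exact hn2 hm1
  · exact hm2 ((hmem m).2 (Or.inl ⟨(hn m h).1 hm1, by omega⟩))
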